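/- Let p1, p2 ∈ [0,1], λ1, λ2 ≥ 0 and (i1, i2) ∈ ℕ². For all real z1 > 0 and z2 > 0, the family (P(Δ1,Δ2 | (i1,i2)) · z1^{Δ1} · z2^{Δ2}) indexed by (Δ1,Δ2) ∈ ℤ² is summable, and Σ_{(Δ1,Δ2)∈ℤ²} P(Δ1,Δ2 | (i1,i2)) · z1^{Δ1} · z2^{Δ2} = exp(λ1·(z1−1)) · exp(λ2·(z2−1)) · (d0(i2,p2) + d1(i2,p2)·z2^{−1}) · (d0(i1,p1) + d1(i1,p1)·z2·z1^{−1}). (Probability generating function of the one-slot state transition for genie-aided inter-session coding.) -/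

import Mathlib

/-- Probability that `x` packets arrive in `b` time slots under a Poisson
arrival process of rate `lam` per slot. -/
noncomputable def arr (lam : ℝ) (b : ℕ) (x : ℤ) : ℝ :=
  if 0 ≤ x then Real.exp (-(lam * b)) * (lam * b) ^ x.toNat / (Nat.factorial x.toNat) else 0

/-- Probability of zero successful transmissions in one slot when the queue holds `i` packets. -/
noncomputable def d0 (i : ℕ) (p : ℝ) : ℝ := if i = 0 then 1 else p

/-- Probability of one successful transmission in one slot when the queue holds `i` packets. -/
noncomputable def d1 (i : ℕ) (p : ℝ) : ℝ := if i = 0 then 0 else 1 - p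

/-- Genie-aided inter-session transition probability `P(Δ1, Δ2 | (i1, i2))`. -/
noncomputable def Ptrans (p1 p2 lam1 lam2 : ℝ) (i1 i2 : ℕ) (Δ : ℤ × ℤ) : ℝ :=
  d0 i1 p1 * arr lam1 1 Δ.1 *
      (d0 i2 p2 * arr lam2 1 Δ.2 + d1 i2 p2 * arr lam2 1 (Δ.2 + 1)) +
    d1 i1 p1 * arr lam1 1 (Δ.1 + 1) *
      (d0 i2 p2 * arr lam2 1 (Δ.2 - 1) + d1 i2 p2 * arr lam2 1 Δ.2)

theorem arr_hasSum (lam z : ℝ) (hz : 0 < z) :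
    HasSum (fun x : ℤ => arr lam 1 x * z ^ x) (Real.exp (lam * (z - 1))) := by
  have hinj : Function.Injective (fun n : ℕ => (n : ℤ)) := Nat.cast_injective
  rw [← hinj.hasSum_iff]
  · have h := (NormedSpace.expSeries_div_hasSum_exp (𝔸 := ℝ) (lam * z)).mul_left (Real.exp (-lam))
    rw [← Real.exp_eq_exp_ℝ, ← Real.exp_add] at h
    have e : lam * (z - 1) = -lam + lam * z := by ring
    rw [e]
    refine h.congr_fun ?_
    intro n
    simp [arr, mul_pow]
    ring
  · intro x hx
    have : ¬ 0 ≤ x := fun h => hx ⟨x.toNat, by simp [h]⟩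
    simp [arr, this]

theorem arr_shift_hasSum (lam z : ℝ) (hz : 0 < z) (k : ℤ) :
    HasSum (fun x : ℤ => arr lam 1 (x + k) * z ^ x) (Real.exp (lam * (z - 1)) * z ^ (-k)) := by
  have h := ((Equiv.addRight k).hasSum_iff.mpr (arr_hasSum lam z hz)).mul_right (z ^ (-k))
  refine h.congr_fun ?_
  intro x
  simp only [Function.comp, Equiv.coe_addRight]
  rw [mul_assoc, ← zpow_add₀ hz.ne']
  simp

theorem prod_hasSum {f g : ℤ → ℝ} {a b : ℝ} (hf : HasSum f a) (hg : HasSum g b) :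
    HasSum (fun Δ : ℤ × ℤ => f Δ.1 * g Δ.2) (a * b) :=
  hf.mul hg (summable_mul_of_summable_norm hf.summable.norm hg.summable.norm)

/-- PGF of the one-slot state transition for genie-aided inter-session coding
(Lemma 1): for `z1, z2 > 0` the family `P(Δ1,Δ2 | (i1,i2)) z1^Δ1 z2^Δ2` is
summable with sum
`exp(λ1(z1−1)) exp(λ2(z2−1)) (d0(i2,p2)+d1(i2,p2) z2⁻¹) (d0(i1,p1)+d1(i1,p1) z2 z1⁻¹)`. -/
theorem genie_intersession_pgf (p1 p2 lam1 lam2 : ℝ)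
    (hp1 : p1 ∈ Set.Icc (0 : ℝ) 1) (hp2 : p2 ∈ Set.Icc (0 : ℝ) 1)
    (hl1 : 0 ≤ lam1) (hl2 : 0 ≤ lam2) (i1 i2 : ℕ)
    (z1 z2 : ℝ) (hz1 : 0 < z1) (hz2 : 0 < z2) :
    HasSum (fun Δ : ℤ × ℤ => Ptrans p1 p2 lam1 lam2 i1 i2 Δ * z1 ^ Δ.1 * z2 ^ Δ.2)
      (Real.exp (lam1 * (z1 - 1)) * Real.exp (lam2 * (z2 - 1)) *
        (d0 i2 p2 + d1 i2 p2 * z2⁻¹) * (d0 i1 p1 + d1 i1 p1 * z2 * z1⁻¹)) := by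
  have A := arr_hasSum lam1 z1 hz1
  have A1 := arr_shift_hasSum lam1 z1 hz1 1
  have B := arr_hasSum lam2 z2 hz2
  have B1 := arr_shift_hasSum lam2 z2 hz2 1
  have B2 := arr_shift_hasSum lam2 z2 hz2 (-1)
  have h1 := prod_hasSum (A.mul_left (d0 i1 p1))
    ((B.mul_left (d0 i2 p2)).add (B1.mul_left (d1 i2 p2)))
  have h2 := prod_hasSum (A1.mul_left (d1 i1 p1))
    ((B2.mul_left (d0 i2 p2)).add (B.mul_left (d1 i2 p2)))
  convert h1.add h2 using 1
  · funext Δ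
    simp only [Ptrans, sub_eq_add_neg]
    ring
  · simp only [neg_neg, zpow_one, zpow_neg]
    field_simp
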